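/- For every n ≥ 1, the number of 5-dimensional balanced ballot paths of length 5n whose semisymmetric height is at most 8 equals 2^{n-1}. -/

import Mathlib

open scoped Classical

/-- Number of steps among the first `i` steps of `P` equal to basis vector `j`. -/
def cnt (k n : ℕ) (P : Fin (k*n) → Fin k) (j : Fin k) (i : ℕ) : ℕ :=
  (Finset.univ.filter (fun t : Fin (k*n) => (t : ℕ) < i ∧ P t = j)).card

/-- `P` is a `k`-dimensional balanced ballot path of length `k*n`:
each basis vector appears exactly `n` times, and every partial sum is
weakly decreasing in coordinates. -/
def IsBBP (k n : ℕ) (P : Fin (k*n) → Fin k) : Prop :=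
  (∀ j : Fin k, cnt k n P j (k*n) = n) ∧
  (∀ i ≤ k*n, ∀ j j' : Fin k, j ≤ j' → cnt k n P j' i ≤ cnt k n P j i)

/-- Semisymmetric height `g_k` of the `i`-th intermediate point of `P`. -/
def ptHt (k n : ℕ) (P : Fin (k*n) → Fin k) (i : ℕ) : ℤ :=
  ∑ j : Fin k, ((k : ℤ) - 1 - 2*(j : ℕ)) * (cnt k n P j i)

/-- The semisymmetric height of path `P` is at most `u`. -/
def HeightLE (k n : ℕ) (P : Fin (k*n) → Fin k) (u : ℤ) : Prop :=
  ∀ i ≤ k*n, ptHt k n P i ≤ u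

/-- The semisymmetric height of path `P` is exactly `u`. -/
def HeightEq (k n : ℕ) (P : Fin (k*n) → Fin k) (u : ℤ) : Prop :=
  HeightLE k n P u ∧ ∃ i ≤ k*n, ptHt k n P i = u

theorem cnt_zero (k n : ℕ) (P : Fin (k*n) → Fin k) (j : Fin k) : cnt k n P j 0 = 0 := by
  simp [cnt]

theorem cnt_succ (k n : ℕ) (P : Fin (k*n) → Fin k) (j : Fin k) (i : ℕ) (hi : i < k*n) :
    cnt k n P j (i+1) = cnt k n P j i + if P ⟨i, hi⟩ = j then 1 else 0 := by
  unfold cnt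
  split_ifs with h
  · rw [← Finset.card_insert_of_notMem (a := (⟨i, hi⟩ : Fin (k*n))) (by simp)]
    congr 1
    ext t
    simp only [Finset.mem_filter, Finset.mem_univ, true_and, Finset.mem_insert, Fin.ext_iff]
    constructor
    · rintro ⟨h1, h2⟩
      by_cases h3 : (t : ℕ) = i
      · exact Or.inl h3
      · exact Or.inr ⟨by omega, h2⟩
    · rintro (h1 | ⟨h1, h2⟩)
      · obtain rfl : t = ⟨i, hi⟩ := Fin.ext h1
        exact ⟨by simp, by rw [h]⟩
      · exact ⟨by omega, h2⟩
  · rw [add_zero]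
    congr 1
    ext t
    simp only [Finset.mem_filter, Finset.mem_univ, true_and]
    constructor
    · rintro ⟨h1, h2⟩
      refine ⟨?_, h2⟩
      by_contra h3
      obtain rfl : t = ⟨i, hi⟩ := Fin.ext (by simp; omega)
      exact h h2
    · rintro ⟨h1, h2⟩
      exact ⟨by omega, h2⟩

/-- The `i`-th partial sum of `P` is the point `(a, b, c, d, e)`. -/
def AtPoint (n : ℕ) (P : Fin (5*n) → Fin 5) (i a b c d e : ℕ) : Prop :=
  cnt 5 n P 0 i = a ∧ cnt 5 n P 1 i = b ∧ cnt 5 n P 2 i = c ∧ cnt 5 n P 3 i = d ∧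
    cnt 5 n P 4 i = e

/-- The point `(a, b, c, d, e)` is weakly decreasing and has semisymmetric height at most 8. -/
def LowPoint (a b c d e : ℕ) : Prop :=
  b ≤ a ∧ c ≤ b ∧ d ≤ c ∧ e ≤ d ∧ 4*a + 2*b ≤ 8 + 2*d + 4*e

theorem isBBP_and_heightLE_iff (n : ℕ) (P : Fin (5*n) → Fin 5) :
    IsBBP 5 n P ∧ HeightLE 5 n P 8 ↔ AtPoint n P (5*n) n n n n n ∧
      ∀ i ≤ 5*n, LowPoint (cnt 5 n P 0 i) (cnt 5 n P 1 i) (cnt 5 n P 2 i) (cnt 5 n P 3 i)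
        (cnt 5 n P 4 i) := by
  constructor
  · rintro ⟨⟨h1, h2⟩, h3⟩
    refine ⟨⟨h1 0, h1 1, h1 2, h1 3, h1 4⟩, fun i hi => ?_⟩
    have h := h3 i hi
    simp only [ptHt, Fin.sum_univ_five] at h
    norm_num at h
    refine ⟨h2 i hi 0 1 (by decide), h2 i hi 1 2 (by decide), h2 i hi 2 3 (by decide),
      h2 i hi 3 4 (by decide), ?_⟩
    omega
  · rintro ⟨⟨h0, h1, h2, h3, h4⟩, h⟩
    refine ⟨⟨fun j => by fin_cases j <;> assumption, fun i hi j j' hj => ?_⟩, fun i hi => ?_⟩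
    · obtain ⟨g1, g2, g3, g4, -⟩ := h i hi
      fin_cases j <;> fin_cases j' <;> simp at hj ⊢ <;> omega
    · obtain ⟨g1, g2, g3, g4, g5⟩ := h i hi
      simp only [ptHt, Fin.sum_univ_five]
      norm_num
      omega

theorem AtPoint.step {n : ℕ} {P : Fin (5*n) → Fin 5} {i a b c d e : ℕ}
    (h : AtPoint n P i a b c d e) (hi : i < 5*n) :
    (P ⟨i, hi⟩ = 0 ∧ AtPoint n P (i+1) (a+1) b c d e) ∨
    (P ⟨i, hi⟩ = 1 ∧ AtPoint n P (i+1) a (b+1) c d e) ∨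
    (P ⟨i, hi⟩ = 2 ∧ AtPoint n P (i+1) a b (c+1) d e) ∨
    (P ⟨i, hi⟩ = 3 ∧ AtPoint n P (i+1) a b c (d+1) e) ∨
    (P ⟨i, hi⟩ = 4 ∧ AtPoint n P (i+1) a b c d (e+1)) := by
  obtain ⟨rfl, rfl, rfl, rfl, rfl⟩ := h
  unfold AtPoint
  simp only [cnt_succ _ _ _ _ _ hi]
  generalize P ⟨i, hi⟩ = p
  fin_cases p <;> simp

theorem atPoint_zero (n : ℕ) (P : Fin (5*n) → Fin 5) : AtPoint n P 0 0 0 0 0 0 := by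
  simp [AtPoint, cnt_zero]

/-- Partial sums of a path of height at most 8 are low. -/
theorem AtPoint.lowPoint {n : ℕ} {P : Fin (5*n) → Fin 5} {i a b c d e : ℕ}
    (h : AtPoint n P i a b c d e) (hP : IsBBP 5 n P ∧ HeightLE 5 n P 8) (hi : i ≤ 5*n) :
    LowPoint a b c d e := by
  have := ((isBBP_and_heightLE_iff n P).1 hP).2 i hi
  obtain ⟨rfl, rfl, rfl, rfl, rfl⟩ := h
  exact this

/-- A path of height at most 8 is forced for three steps after a point
`(m + 1, m, m, m, m)`. -/
theorem AtPoint.forced {n m : ℕ} {P : Fin (5*n) → Fin 5} (hP : IsBBP 5 n P ∧ HeightLE 5 n P 8)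
    (hm : m < n) (h : AtPoint n P (5*m+1) (m+1) m m m m) :
    P ⟨5*m+1, by omega⟩ = 1 ∧ P ⟨5*m+2, by omega⟩ = 2 ∧ P ⟨5*m+3, by omega⟩ = 3 ∧
      AtPoint n P (5*m+4) (m+1) (m+1) (m+1) (m+1) m := by
  have h2 : P ⟨5*m+1, by omega⟩ = 1 ∧ AtPoint n P (5*m+2) (m+1) (m+1) m m m := by
    rcases h.step (by omega) with ⟨p, q⟩ | ⟨p, q⟩ | ⟨p, q⟩ | ⟨p, q⟩ | ⟨p, q⟩
    · exfalso
      rcases q.step (by omega) with ⟨p, r⟩ | ⟨p, r⟩ | ⟨p, r⟩ | ⟨p, r⟩ | ⟨p, r⟩ <;>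
      · have := r.lowPoint hP (by omega)
        unfold LowPoint at this
        omega
    · exact ⟨p, q⟩
    all_goals
      have := q.lowPoint hP (by omega)
      unfold LowPoint at this
      omega
  have h3 : P ⟨5*m+2, by omega⟩ = 2 ∧ AtPoint n P (5*m+3) (m+1) (m+1) (m+1) m m := by
    rcases h2.2.step (by omega) with ⟨p, q⟩ | ⟨p, q⟩ | ⟨p, q⟩ | ⟨p, q⟩ | ⟨p, q⟩
    on_goal 3 => exact ⟨p, q⟩
    all_goals
      have := q.lowPoint hP (by omega)
      unfold LowPoint at this
      omega
  have h4 : P ⟨5*m+3, by omega⟩ = 3 ∧ AtPoint n P (5*m+4) (m+1) (m+1) (m+1) (m+1) m := by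
    rcases h3.2.step (by omega) with ⟨p, q⟩ | ⟨p, q⟩ | ⟨p, q⟩ | ⟨p, q⟩ | ⟨p, q⟩
    on_goal 4 => exact ⟨p, q⟩
    all_goals
      have := q.lowPoint hP (by omega)
      unfold LowPoint at this
      omega
  exact ⟨h2.1, h3.1, h4.1, h4.2⟩

/-- After the forced steps, a path of height at most 8 takes either `e₅, e₁` or `e₁, e₅`. -/
theorem AtPoint.choice {n m : ℕ} {P : Fin (5*n) → Fin 5} (hP : IsBBP 5 n P ∧ HeightLE 5 n P 8)
    (hm : m + 1 < n) (h : AtPoint n P (5*m+4) (m+1) (m+1) (m+1) (m+1) m) :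
    (P ⟨5*m+4, by omega⟩ = 0 ∧ P ⟨5*(m+1), by omega⟩ = 4 ∨
      P ⟨5*m+4, by omega⟩ = 4 ∧ P ⟨5*(m+1), by omega⟩ = 0) ∧
      AtPoint n P (5*(m+1)+1) (m+1+1) (m+1) (m+1) (m+1) (m+1) := by
  rcases h.step (by omega) with ⟨p, q⟩ | ⟨p, q⟩ | ⟨p, q⟩ | ⟨p, q⟩ | ⟨p, q⟩
  · rcases q.step (by omega) with ⟨p', r⟩ | ⟨p', r⟩ | ⟨p', r⟩ | ⟨p', r⟩ | ⟨p', r⟩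
    on_goal 5 => exact ⟨Or.inl ⟨p, p'⟩, r⟩
    all_goals
      have := r.lowPoint hP (by omega)
      unfold LowPoint at this
      omega
  on_goal 4 =>
    rcases q.step (by omega) with ⟨p', r⟩ | ⟨p', r⟩ | ⟨p', r⟩ | ⟨p', r⟩ | ⟨p', r⟩
    on_goal 1 => exact ⟨Or.inr ⟨p, p'⟩, r⟩
    all_goals
      have := r.lowPoint hP (by omega)
      unfold LowPoint at this
      omega
  all_goals
    have := q.lowPoint hP (by omega)
    unfold LowPoint at this
    omega

theorem atPoint_first {n : ℕ} {P : Fin (5*n) → Fin 5} (hP : IsBBP 5 n P ∧ HeightLE 5 n P 8)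
    (hn : 0 < n) : P ⟨0, by omega⟩ = 0 ∧ AtPoint n P 1 1 0 0 0 0 := by
  rcases (atPoint_zero n P).step (by omega) with ⟨p, q⟩ | ⟨p, q⟩ | ⟨p, q⟩ | ⟨p, q⟩ | ⟨p, q⟩
  on_goal 1 => exact ⟨p, q⟩
  all_goals
    have := q.lowPoint hP (by omega)
    unfold LowPoint at this
    omega

theorem atPoint_of_low {n : ℕ} {P : Fin (5*n) → Fin 5} (hP : IsBBP 5 n P ∧ HeightLE 5 n P 8)
    (m : ℕ) (hm : m < n) : AtPoint n P (5*m+1) (m+1) m m m m := by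
  induction m with
  | zero => exact (atPoint_first hP hm).2
  | succ m ih =>
    exact (AtPoint.choice hP hm (AtPoint.forced hP (by omega) (ih (by omega))).2.2.2).2

theorem last_of_low {n m : ℕ} {P : Fin (5*n) → Fin 5} (hP : IsBBP 5 n P ∧ HeightLE 5 n P 8)
    (hm : m + 1 = n) : P ⟨5*m+4, by omega⟩ = 4 := by
  have h := (AtPoint.forced hP (by omega) (atPoint_of_low hP m (by omega))).2.2.2
  have he := ((isBBP_and_heightLE_iff n P).1 hP).1
  have e : 5*n = 5*m+4+1 := by omega
  rcases h.step (by omega) with ⟨p, q⟩ | ⟨p, q⟩ | ⟨p, q⟩ | ⟨p, q⟩ | ⟨p, q⟩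
  on_goal 5 => exact p
  all_goals
    unfold AtPoint at q he
    rw [← e] at q
    omega

/-- The `t`-th step of the path whose choices are recorded by `β`: `β m` says that the steps
`5m + 4` and `5m + 5` are `e₁, e₅` rather than `e₅, e₁`. -/
def choiceStep (β : ℕ → Bool) (t : ℕ) : Fin 5 :=
  if t % 5 = 0 then (if 5 ≤ t ∧ β (t/5 - 1) then 4 else 0)
  else if t % 5 = 1 then 1
  else if t % 5 = 2 then 2
  else if t % 5 = 3 then 3
  else (if β (t/5) then 0 else 4)

theorem choiceStep_zero (β : ℕ → Bool) : choiceStep β 0 = 0 := by simp [choiceStep]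

theorem choiceStep_one (β : ℕ → Bool) (m : ℕ) : choiceStep β (5*m+1) = 1 := by
  have : (5*m+1) % 5 = 1 := by omega
  simp [choiceStep, this]

theorem choiceStep_two (β : ℕ → Bool) (m : ℕ) : choiceStep β (5*m+2) = 2 := by
  have : (5*m+2) % 5 = 2 := by omega
  simp [choiceStep, this]

theorem choiceStep_three (β : ℕ → Bool) (m : ℕ) : choiceStep β (5*m+3) = 3 := by
  have : (5*m+3) % 5 = 3 := by omega
  simp [choiceStep, this]

theorem choiceStep_four (β : ℕ → Bool) (m : ℕ) :
    choiceStep β (5*m+4) = if β m then 0 else 4 := by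
  have : (5*m+4) % 5 = 4 := by omega
  have h : (5*m+4) / 5 = m := by omega
  simp [choiceStep, this, h]

theorem choiceStep_five (β : ℕ → Bool) (m : ℕ) :
    choiceStep β (5*(m+1)) = if β m then 4 else 0 := by
  have : (5*(m+1)) % 5 = 0 := by omega
  have h : (5*(m+1)) / 5 - 1 = m := by omega
  have h5 : 5 ≤ 5*(m+1) := by omega
  simp only [choiceStep, this, h, h5, true_and, if_true]

theorem atPoint_choiceStep_succ {n i a b c d e : ℕ} {β : ℕ → Bool} (hi : i < 5*n)
    (h : AtPoint n (fun t => choiceStep β t) i a b c d e) :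
    AtPoint n (fun t => choiceStep β t) (i+1)
      (a + if choiceStep β i = 0 then 1 else 0) (b + if choiceStep β i = 1 then 1 else 0)
      (c + if choiceStep β i = 2 then 1 else 0) (d + if choiceStep β i = 3 then 1 else 0)
      (e + if choiceStep β i = 4 then 1 else 0) := by
  obtain ⟨rfl, rfl, rfl, rfl, rfl⟩ := h
  simp [AtPoint, cnt_succ _ _ _ _ _ hi]

theorem atPoint_choiceStep_block {n m : ℕ} {β : ℕ → Bool} (hm : m < n)
    (h : AtPoint n (fun t => choiceStep β t) (5*m+1) (m+1) m m m m) :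
    AtPoint n (fun t => choiceStep β t) (5*m+2) (m+1) (m+1) m m m ∧
    AtPoint n (fun t => choiceStep β t) (5*m+3) (m+1) (m+1) (m+1) m m ∧
    AtPoint n (fun t => choiceStep β t) (5*m+4) (m+1) (m+1) (m+1) (m+1) m ∧
    AtPoint n (fun t => choiceStep β t) (5*(m+1)) (m+1+if β m then 1 else 0) (m+1) (m+1) (m+1)
      (m + if β m then 0 else 1) := by
  have h2 := atPoint_choiceStep_succ (by omega) h
  simp [choiceStep_one] at h2
  have h3 := atPoint_choiceStep_succ (by omega) h2
  simp [choiceStep_two] at h3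
  have h4 := atPoint_choiceStep_succ (by omega) h3
  simp [choiceStep_three] at h4
  have h5 := atPoint_choiceStep_succ (by omega) h4
  refine ⟨h2, h3, h4, ?_⟩
  rw [choiceStep_four] at h5
  cases hb : β m <;> simp [hb] at h5 ⊢ <;> exact h5

theorem atPoint_choiceStep {n : ℕ} {β : ℕ → Bool} (m : ℕ) (hm : m < n) :
    AtPoint n (fun t => choiceStep β t) (5*m+1) (m+1) m m m m := by
  induction m with
  | zero =>
    have h := atPoint_choiceStep_succ (β := β) (by omega) (atPoint_zero n _)
    simpa [choiceStep_zero] using h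
  | succ m ih =>
    have h := (atPoint_choiceStep_block (by omega) (ih (by omega))).2.2.2
    have h' := atPoint_choiceStep_succ (by omega) h
    rw [choiceStep_five] at h'
    cases hb : β m <;> simp [hb] at h' ⊢ <;> exact h'

theorem low_choiceStep {n : ℕ} {β : ℕ → Bool} (hn : 1 ≤ n) (hβ : β (n-1) = false) :
    IsBBP 5 n (fun t => choiceStep β t) ∧ HeightLE 5 n (fun t => choiceStep β t) 8 := by
  rw [isBBP_and_heightLE_iff]
  constructor
  · obtain ⟨m, rfl⟩ : ∃ m, n = m + 1 := ⟨n - 1, by omega⟩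
    have h := (atPoint_choiceStep_block (by omega)
      (atPoint_choiceStep (n := m+1) (β := β) m (by omega))).2.2.2
    rw [Nat.add_sub_cancel] at hβ
    simpa [hβ] using h
  · intro i hi
    have key : ∀ {a b c d e : ℕ}, AtPoint n (fun t => choiceStep β t) i a b c d e →
        LowPoint a b c d e → LowPoint (cnt 5 n (fun t => choiceStep β t) 0 i)
          (cnt 5 n (fun t => choiceStep β t) 1 i) (cnt 5 n (fun t => choiceStep β t) 2 i)
          (cnt 5 n (fun t => choiceStep β t) 3 i) (cnt 5 n (fun t => choiceStep β t) 4 i) := by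
      rintro a b c d e ⟨rfl, rfl, rfl, rfl, rfl⟩ h
      exact h
    rcases Nat.eq_zero_or_pos i with rfl | hpos
    · exact key (atPoint_zero n _) (by simp [LowPoint])
    · obtain ⟨m, r, hr, rfl⟩ : ∃ m r, r < 5 ∧ i = 5*m+1+r :=
        ⟨(i-1)/5, (i-1)%5, by omega, by omega⟩
      have h1 := atPoint_choiceStep (n := n) (β := β) m (by omega)
      obtain ⟨h2, h3, h4, h5⟩ := atPoint_choiceStep_block (by omega) h1
      interval_cases r
      · exact key h1 (by unfold LowPoint; omega)
      · exact key h2 (by unfold LowPoint; omega)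
      · exact key h3 (by unfold LowPoint; omega)
      · exact key h4 (by unfold LowPoint; omega)
      · exact key h5 (by unfold LowPoint; split_ifs <;> omega)

theorem eq_choiceStep_of_low {n : ℕ} {P : Fin (5*n) → Fin 5}
    (hP : IsBBP 5 n P ∧ HeightLE 5 n P 8) {β : ℕ → Bool} (hβ : β (n-1) = false)
    (h : ∀ m, ∀ hm : m + 1 < n, β m = decide (P ⟨5*m+4, by omega⟩ = 0)) :
    P = fun t : Fin (5*n) => choiceStep β t := by
  funext ⟨t, ht⟩
  obtain ⟨m, r, hr, rfl⟩ : ∃ m r, r < 5 ∧ t = 5*m+r := ⟨t/5, t%5, by omega, by omega⟩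
  obtain ⟨h1, h2, h3, h4⟩ := AtPoint.forced hP (by omega) (atPoint_of_low hP m (by omega))
  interval_cases r
  · rcases m with _ | m
    · simpa [choiceStep_zero] using (atPoint_first hP (by omega)).1
    · have h4' := (AtPoint.forced hP (by omega) (atPoint_of_low hP m (by omega))).2.2.2
      have hm := h m (by omega)
      simp only [add_zero, choiceStep_five]
      rcases (AtPoint.choice hP (by omega) h4').1 with ⟨p, q⟩ | ⟨p, q⟩ <;>
        simp [p] at hm <;> simp [hm, q]
  · simpa [choiceStep_one] using h1
  · simpa [choiceStep_two] using h2
  · simpa [choiceStep_three] using h3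
  · simp only [choiceStep_four]
    rcases Nat.lt_or_ge (m+1) n with hlt | hge
    · have hm := h m hlt
      rcases (AtPoint.choice hP hlt h4).1 with ⟨p, q⟩ | ⟨p, q⟩ <;>
        simp [p] at hm <;> simp [hm, p]
    · have e : n - 1 = m := by omega
      rw [e] at hβ
      simpa [hβ] using last_of_low hP (show m + 1 = n by omega)

/-- A finite sequence of choices, extended by `false`. -/
def extendChoices {n : ℕ} (b : Fin (n-1) → Bool) (m : ℕ) : Bool :=
  if h : m < n - 1 then b ⟨m, h⟩ else false

/-- Paths of height at most 8 correspond to sequences of `n - 1` binary choices. -/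
noncomputable def lowPathEquiv (n : ℕ) (hn : 1 ≤ n) :
    {P : Fin (5*n) → Fin 5 // IsBBP 5 n P ∧ HeightLE 5 n P 8} ≃ (Fin (n-1) → Bool) where
  toFun P m := decide (P.1 ⟨5*m+4, by omega⟩ = 0)
  invFun b := ⟨fun t => choiceStep (extendChoices b) t,
    low_choiceStep hn (by simp [extendChoices])⟩
  left_inv P := by
    refine Subtype.ext (eq_choiceStep_of_low P.2 (by simp [extendChoices]) fun m hm => ?_).symm
    simp [extendChoices, show m < n - 1 by omega]
  right_inv b := by
    funext m
    have h : extendChoices b m = b m := by simp [extendChoices]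
    simp only [choiceStep_four, h]
    cases b m <;> simp

theorem stmt12 (n : ℕ) (hn : 1 ≤ n) :
    Nat.card {P : Fin (5*n) → Fin 5 // IsBBP 5 n P ∧ HeightLE 5 n P 8} = 2^(n-1) := by
  rw [Nat.card_congr (lowPathEquiv n hn)]
  simp
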